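/- arXiv:1101.0492 — 2 statements merged into one kernel-verified Lean document; each statement's English description precedes it below -/
import Mathlib

section
/- Let x and y be two distinct positive rational numbers with x·y = 3, and let h = 2/(1/x + 1/y) be their harmonic mean. Then 3 divides the numerator of h when h is written as a fraction in lowest terms. -/
theorem three_dvd_num_of_harmonic_mean (x y : ℚ) (hx : 0 < x) (hy : 0 < y)
    (hxy : x ≠ y) (hprod : x * y = 3) :
    (3 : ℤ) ∣ (2 / (1 / x + 1 / y) : ℚ).num := by
  have hp : Prime (3 : ℤ) := Int.prime_three
  have h1 : (2 / (1 / x + 1 / y) : ℚ) * (x ^ 2 + 3) = 6 * x := by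
    have hy' : y = 3 / x := by field_simp; linarith
    subst hy'
    field_simp
    ring
  generalize (2 / (1 / x + 1 / y) : ℚ) = h at h1 ⊢
  have hbq : (x.den : ℚ) ≠ 0 := by exact_mod_cast x.den_nz
  have hdq : (h.den : ℚ) ≠ 0 := by exact_mod_cast h.den_nz
  have h2 : h.num * (x.num ^ 2 + 3 * (x.den : ℤ) ^ 2) = 6 * x.num * x.den * h.den := by
    have e1 : h * h.den = h.num := Rat.mul_den_eq_num h
    have e2 : x * x.den = x.num := Rat.mul_den_eq_num x
    have : (h.num : ℚ) * ((x.num : ℚ) ^ 2 + 3 * (x.den : ℚ) ^ 2)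
        = 6 * x.num * x.den * h.den := by
      rw [← e1, ← e2]
      linear_combination (h.den : ℚ) * (x.den : ℚ) ^ 2 * h1
    exact_mod_cast this
  have hco : IsCoprime x.num (x.den : ℤ) := Rat.isCoprime_num_den x
  generalize x.num = a at h2 hco
  generalize (x.den : ℤ) = b at h2 hco
  by_cases ha : (3 : ℤ) ∣ a
  · have hb : ¬ (3 : ℤ) ∣ b := fun hb => hp.not_unit (hco.isUnit_of_dvd' ha hb)
    obtain ⟨c, rfl⟩ := ha
    have h3 : h.num * (3 * c ^ 2 + b ^ 2) = 3 * (2 * c * b * h.den) := by linarith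
    rcases hp.dvd_or_dvd (Dvd.intro _ h3.symm) with h4 | h4
    · exact h4
    · exact absurd (hp.dvd_of_dvd_pow ((dvd_add_right (Dvd.intro _ rfl)).1 h4)) hb
  · have h3 : h.num * (a ^ 2 + 3 * b ^ 2) = 3 * (2 * a * b * h.den) := by linarith
    rcases hp.dvd_or_dvd (Dvd.intro _ h3.symm) with h4 | h4
    · exact h4
    · exact absurd (hp.dvd_of_dvd_pow ((dvd_add_left (Dvd.intro _ rfl)).1 h4)) ha
end

section
/- The 96-gon semiperimeters already separate Archimedes' bounds from π: 3 + 10/71 < 96·sin(π/96) and 96·tan(π/96) < 3 + 1/7. -/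
theorem ninety_six_gon_separates_archimedes_bounds :
    (3 + 10 / 71 : ℝ) < 96 * Real.sin (Real.pi / 96) ∧
      96 * Real.tan (Real.pi / 96) < (3 + 1 / 7 : ℝ) := by
  have h1 := Real.pi_gt_d6
  have h2 := Real.pi_lt_d6
  obtain ⟨x, hx⟩ : ∃ x, x = Real.pi / 96 := ⟨_, rfl⟩
  rw [← hx]
  have l : 3.141592 / 96 < x := by rw [hx]; linarith
  have u : x < 3.141593 / 96 := by rw [hx]; linarith
  have x0 : 0 < x := lt_trans (by norm_num) l
  have u2 : x ^ 2 ≤ (3.141593 / 96) ^ 2 := by gcongr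
  have u3 : x ^ 3 ≤ (3.141593 / 96) ^ 3 := by gcongr
  have l3 : (3.141592 / 96) ^ 3 ≤ x ^ 3 := by gcongr
  have u5 : x ^ 5 ≤ (3.141593 / 96) ^ 5 := by gcongr
  have hs := Real.sin_gt_sub_cube x0
  have hc := Real.one_sub_sq_div_two_le_cos (x := x)
  have ha : |x| = x := abs_of_pos x0
  have hb := Real.sin_bound (x := x) (by rw [ha]; exact u.le.trans (by norm_num))
  rw [ha] at hb
  have hb' := (abs_le.mp hb).2
  norm_num at l u u2 u3 l3 u5
  constructor
  · linarith
  · have hcos : 0 < Real.cos x := by linarith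
    rw [Real.tan_eq_sin_div_cos, ← mul_div_assoc, div_lt_iff₀ hcos]
    linarith
end
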